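/- arXiv:math-ph/0702072 — 14 statements merged into one kernel-verified Lean document; each statement's English description precedes it below -/
import Mathlib

section
/- Let f, H, K : ℝ → ℝ with H continuously differentiable and f, K continuous, and let u : ℝ × ℝ → ℝ be twice continuously differentiable and satisfy f(x)·∂ₜₜu = ∂ₓ(H(u)·∂ₓu) + K(u)·∂ₓu on ℝ². Let ε₁, ε₂, ε₃ ∈ ℝ and ε₄, ε₅, ε₆, ε₇ ∈ ℝ \ {0}. Define ũ(t,x) := ε₆·u((t−ε₁)/ε₄, (x−ε₂)/ε₅) + ε₃, f̃(x) := ε₄²·ε₅⁻²·ε₇·f((x−ε₂)/ε₅), H̃(v) := ε₇·H((v−ε₃)/ε₆), and K̃(v) := ε₇·ε₅⁻¹·K((v−ε₃)/ε₆). Then f̃(x)·∂ₜₜũ(t,x) = ∂ₓ(H̃(ũ(t,x))·∂ₓũ(t,x)) + K̃(ũ(t,x))·∂ₓũ(t,x) for all (t,x) ∈ ℝ². (These are the continuous equivalence transformations of the class generated by its equivalence algebra.) -/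
/-- First-order partial derivative of `u(t,x)` with respect to `t`. -/
noncomputable def pt (u : ℝ × ℝ → ℝ) (t x : ℝ) : ℝ :=
  deriv (fun s => u (s, x)) t

/-- First-order partial derivative of `u(t,x)` with respect to `x`. -/
noncomputable def px (u : ℝ × ℝ → ℝ) (t x : ℝ) : ℝ :=
  deriv (fun y => u (t, y)) x

/-- Second-order partial derivative of `u(t,x)` with respect to `t`. -/
noncomputable def ptt (u : ℝ × ℝ → ℝ) (t x : ℝ) : ℝ :=
  deriv (fun s => pt u s x) t


/-- Chain rule for a function pre- and post-composed with affine maps of the line; no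
differentiability is needed. -/
theorem deriv_affine_comp_affine (g : ℝ → ℝ) (a b c d x : ℝ) :
    deriv (fun y => c * g ((y - a) / b) + d) x = c / b * deriv g ((x - a) / b) := by
  have h : deriv (fun y => g ((y - a) / b)) x = b⁻¹ * deriv g ((x - a) / b) := by
    have h₁ := deriv_comp_sub_const (f := fun z => g (b⁻¹ * z)) a x
    rw [deriv_comp_mul_left] at h₁
    simpa [div_eq_inv_mul] using h₁
  rw [deriv_add_const, deriv_const_mul_field, h]
  ring

/-- The continuous equivalence transformations of the class
`f(x) u_tt = (H(u) u_x)_x + K(u) u_x` map solutions to solutions of the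
transformed equation. -/
theorem equivalence_transformations
    (f H K : ℝ → ℝ) (hH : ContDiff ℝ 1 H) (hf : Continuous f) (hK : Continuous K)
    (u : ℝ × ℝ → ℝ) (hu : ContDiff ℝ 2 u)
    (heq : ∀ t x : ℝ,
      f x * ptt u t x
        = deriv (fun y => H (u (t, y)) * px u t y) x + K (u (t, x)) * px u t x)
    (e1 e2 e3 e4 e5 e6 e7 : ℝ)
    (h4 : e4 ≠ 0) (h5 : e5 ≠ 0) (h6 : e6 ≠ 0) (h7 : e7 ≠ 0)
    (v : ℝ × ℝ → ℝ) (hv : v = fun p => e6 * u ((p.1 - e1) / e4, (p.2 - e2) / e5) + e3)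
    (ftil Htil Ktil : ℝ → ℝ)
    (hftil : ftil = fun x => e4 ^ 2 * (e5 ^ 2)⁻¹ * e7 * f ((x - e2) / e5))
    (hHtil : Htil = fun w => e7 * H ((w - e3) / e6))
    (hKtil : Ktil = fun w => e7 * e5⁻¹ * K ((w - e3) / e6)) :
    ∀ t x : ℝ,
      ftil x * ptt v t x
        = deriv (fun y => Htil (v (t, y)) * px v t y) x + Ktil (v (t, x)) * px v t x := by
  intro t x
  subst hv hftil hHtil hKtil
  have hpx : ∀ y, px (fun p => e6 * u ((p.1 - e1) / e4, (p.2 - e2) / e5) + e3) t y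
      = e6 / e5 * px u ((t - e1) / e4) ((y - e2) / e5) := fun y =>
    deriv_affine_comp_affine (fun z => u ((t - e1) / e4, z)) e2 e5 e6 e3 y
  have hpt : ∀ s, pt (fun p => e6 * u ((p.1 - e1) / e4, (p.2 - e2) / e5) + e3) s x
      = e6 / e4 * pt u ((s - e1) / e4) ((x - e2) / e5) := fun s =>
    deriv_affine_comp_affine (fun z => u (z, (x - e2) / e5)) e1 e4 e6 e3 s
  have hptt : ptt (fun p => e6 * u ((p.1 - e1) / e4, (p.2 - e2) / e5) + e3) t x
      = e6 / e4 / e4 * ptt u ((t - e1) / e4) ((x - e2) / e5) := by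
    have h := deriv_affine_comp_affine (fun z => pt u z ((x - e2) / e5)) e1 e4 (e6 / e4) 0 t
    simp only [add_zero] at h
    simpa only [ptt, hpt] using h
  have hinv : ∀ w, (e6 * w + e3 - e3) / e6 = w := fun w => by field_simp; ring
  have hflux : deriv (fun y => e7 * H (u ((t - e1) / e4, (y - e2) / e5))
        * (e6 / e5 * px u ((t - e1) / e4) ((y - e2) / e5))) x
      = e7 * e6 / e5 / e5 * deriv (fun z => H (u ((t - e1) / e4, z)) * px u ((t - e1) / e4) z)
          ((x - e2) / e5) := by
    rw [← deriv_affine_comp_affine _ e2 e5 (e7 * e6 / e5) 0 x]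
    congr 1
    funext y
    ring
  simp only [hpx, hptt, hinv, hflux]
  have h := heq ((t - e1) / e4) ((x - e2) / e5)
  calc _ = e7 * e6 / e5 / e5 * (f ((x - e2) / e5) * ptt u ((t - e1) / e4) ((x - e2) / e5)) := by
        field_simp
    _ = _ := by
        rw [h]
        ring
end

section
/- Let H, K : ℝ → ℝ with H continuously differentiable and K continuous, and let u : ℝ × ℝ → ℝ be twice continuously differentiable and satisfy e^x·∂ₜₜu(t,x) = ∂ₓ(H(u(t,x))·∂ₓu(t,x)) + K(u(t,x))·∂ₓu(t,x) for all (t,x) ∈ ℝ². Then for every s ∈ ℝ, the function v(t,x) := u(e^{−s}·t, x − 2s) satisfies the same equation e^x·∂ₜₜv(t,x) = ∂ₓ(H(v(t,x))·∂ₓv(t,x)) + K(v(t,x))·∂ₓv(t,x) for all (t,x) ∈ ℝ². (This is the finite symmetry generated by the operator t∂_t + 2∂_x of the case f(x) = e^x with arbitrary H, K.) -/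
theorem pt_scale_translate (u : ℝ × ℝ → ℝ) (c a t x : ℝ) :
    pt (fun p => u (c * p.1, p.2 - a)) t x = c * pt u (c * t) (x - a) :=
  deriv_comp_mul_left c (fun r => u (r, x - a)) t

theorem px_scale_translate (u : ℝ × ℝ → ℝ) (c a t x : ℝ) :
    px (fun p => u (c * p.1, p.2 - a)) t x = px u (c * t) (x - a) :=
  deriv_comp_sub_const (f := fun y => u (c * t, y)) a x

theorem ptt_scale_translate (u : ℝ × ℝ → ℝ) (c a t x : ℝ) :
    ptt (fun p => u (c * p.1, p.2 - a)) t x = c ^ 2 * ptt u (c * t) (x - a) := by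
  have h := deriv_comp_mul_left c (fun r => pt u r (x - a)) t
  simp only [ptt, pt_scale_translate, deriv_const_mul_field, smul_eq_mul] at h ⊢
  rw [h]
  ring

/-- The finite symmetry generated by `t ∂_t + 2 ∂_x` for the case `f(x) = e^x`
with arbitrary `H`, `K`. -/
theorem symmetry_fexp
    (H K : ℝ → ℝ) (hH : ContDiff ℝ 1 H) (hK : Continuous K)
    (u : ℝ × ℝ → ℝ) (hu : ContDiff ℝ 2 u)
    (heq : ∀ t x : ℝ,
      Real.exp x * ptt u t x
        = deriv (fun y => H (u (t, y)) * px u t y) x + K (u (t, x)) * px u t x)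
    (s : ℝ) (v : ℝ × ℝ → ℝ)
    (hv : v = fun p => u (Real.exp (-s) * p.1, p.2 - 2 * s)) :
    ∀ t x : ℝ,
      Real.exp x * ptt v t x
        = deriv (fun y => H (v (t, y)) * px v t y) x + K (v (t, x)) * px v t x := by
  intro t x
  subst hv
  have hflux := deriv_comp_sub_const
    (f := fun y => H (u (Real.exp (-s) * t, y)) * px u (Real.exp (-s) * t) y) (2 * s) x
  have hexp : Real.exp x * Real.exp (-s) ^ 2 = Real.exp (x - 2 * s) := by
    rw [← Real.exp_nat_mul, ← Real.exp_add]
    congr 1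
    push_cast
    ring
  simp only [ptt_scale_translate, px_scale_translate]
  rw [hflux, ← mul_assoc, hexp]
  exact heq _ _
end

section
/- Let μ, ν, λ ∈ ℝ and let u : ℝ × (0,∞) → ℝ be twice continuously differentiable and satisfy x^λ·∂ₜₜu(t,x) = ∂ₓ(e^{μ·u(t,x)}·∂ₓu(t,x)) + e^{ν·u(t,x)}·∂ₓu(t,x) for all t ∈ ℝ, x > 0. Set a := λ(μ−ν) + (μ−2ν). Then for every s ∈ ℝ, the function v(t,x) := u(e^{−a·s}·t, e^{−2(μ−ν)s}·x) + 2s satisfies x^λ·∂ₜₜv(t,x) = ∂ₓ(e^{μ·v(t,x)}·∂ₓv(t,x)) + e^{ν·v(t,x)}·∂ₓv(t,x) for all t ∈ ℝ, x > 0. (This is the finite symmetry generated by the operator [λ(μ−ν)+(μ−2ν)]t∂_t + 2(μ−ν)x∂_x + 2∂_u of the case H = e^{μu}, K = e^{νu}, f = x^λ.) -/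
/-- The finite symmetry generated by `[λ(μ−ν)+(μ−2ν)] t ∂_t + 2(μ−ν) x ∂_x + 2 ∂_u`
for the case `H = e^{μu}`, `K = e^{νu}`, `f = x^λ`. -/
theorem symmetry_Hexp_Kexp_fpower
    (m n l : ℝ)
    (u : ℝ × ℝ → ℝ) (hu : ContDiffOn ℝ 2 u ((Set.univ : Set ℝ) ×ˢ Set.Ioi (0 : ℝ)))
    (heq : ∀ t x : ℝ, 0 < x →
      x ^ l * ptt u t x
        = deriv (fun y => Real.exp (m * u (t, y)) * px u t y) x
          + Real.exp (n * u (t, x)) * px u t x)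
    (s : ℝ) (v : ℝ × ℝ → ℝ)
    (hv : v = fun p =>
      u (Real.exp (-(l * (m - n) + (m - 2 * n)) * s) * p.1,
         Real.exp (-(2 * (m - n)) * s) * p.2) + 2 * s) :
    ∀ t x : ℝ, 0 < x →
      x ^ l * ptt v t x
        = deriv (fun y => Real.exp (m * v (t, y)) * px v t y) x
          + Real.exp (n * v (t, x)) * px v t x := by
  intro t x hx
  set A := Real.exp (-(l * (m - n) + (m - 2 * n)) * s) with hA
  set B := Real.exp (-(2 * (m - n)) * s) with hB
  have hB0 : 0 < B := Real.exp_pos _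
  have hvval : ∀ t x, v (t, x) = u (A * t, B * x) + 2 * s := fun t x => by rw [hv]
  have hpx : ∀ t x, px v t x = B * px u (A * t) (B * x) := by
    intro t x
    simp only [px, hvval, deriv_add_const]
    exact deriv_comp_mul_left B (fun y => u (A * t, y)) x
  have hpt : ∀ t x, pt v t x = A * pt u (A * t) (B * x) := by
    intro t x
    simp only [pt, hvval, deriv_add_const]
    exact deriv_comp_mul_left A (fun r => u (r, B * x)) t
  have hptt : ptt v t x = A * (A * ptt u (A * t) (B * x)) := by
    simp only [ptt, hpt, deriv_const_mul_field]
    congr 1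
    exact deriv_comp_mul_left A (fun r => pt u r (B * x)) t
  have hexp : ∀ k y, Real.exp (k * v (t, y))
      = Real.exp (k * (2 * s)) * Real.exp (k * u (A * t, B * y)) := by
    intro k y
    rw [hvval, ← Real.exp_add]
    ring_nf
  have hflux : deriv (fun y => Real.exp (m * v (t, y)) * px v t y) x
      = Real.exp (m * (2 * s)) * B * (B *
        deriv (fun y => Real.exp (m * u (A * t, y)) * px u (A * t) y) (B * x)) := by
    have hfun : (fun y => Real.exp (m * v (t, y)) * px v t y)
        = fun y => Real.exp (m * (2 * s)) * B *
          (Real.exp (m * u (A * t, B * y)) * px u (A * t) (B * y)) := by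
      funext y
      rw [hexp, hpx]
      ring
    rw [hfun, deriv_const_mul_field]
    congr 1
    exact deriv_comp_mul_left B
      (fun y => Real.exp (m * u (A * t, y)) * px u (A * t) y) x
  have hpde := heq (A * t) (B * x) (mul_pos hB0 hx)
  rw [Real.mul_rpow hB0.le hx.le] at hpde
  have hflux_scale : Real.exp (m * (2 * s)) * B * B = Real.exp (n * (2 * s)) * B := by
    simp only [hB, ← Real.exp_add]
    ring_nf
  have htime_scale : A * A = Real.exp (n * (2 * s)) * B * B ^ l := by
    simp only [hA, hB, ← Real.exp_mul, ← Real.exp_add]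
    ring_nf
  rw [hptt, hflux, hexp, hpx]
  linear_combination (x ^ l * ptt u (A * t) (B * x)) * htime_scale
    + Real.exp (n * (2 * s)) * B * hpde
    - deriv (fun y => Real.exp (m * u (A * t, y)) * px u (A * t) y) (B * x) * hflux_scale
end

section
/- Let μ, ν, λ ∈ ℝ and let u : ℝ × (0,∞) → (0,∞) be twice continuously differentiable and satisfy x^λ·∂ₜₜu(t,x) = ∂ₓ(u(t,x)^μ·∂ₓu(t,x)) + u(t,x)^ν·∂ₓu(t,x) for all t ∈ ℝ, x > 0 (with positive real powers u^μ = exp(μ·ln u)). Set a := λ(μ−ν) + (μ−2ν). Then for every s ∈ ℝ, the function v(t,x) := e^{2s}·u(e^{−a·s}·t, e^{−2(μ−ν)s}·x) satisfies x^λ·∂ₜₜv(t,x) = ∂ₓ(v(t,x)^μ·∂ₓv(t,x)) + v(t,x)^ν·∂ₓv(t,x) for all t ∈ ℝ, x > 0. (This is the finite symmetry generated by the operator [λ(μ−ν)+(μ−2ν)]t∂_t + 2(μ−ν)x∂_x + 2u∂_u of the case H = u^μ, K = u^ν, f = x^λ.) -/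
theorem pt_scale (c A B : ℝ) (u : ℝ × ℝ → ℝ) (t x : ℝ) :
    pt (fun p => c * u (A * p.1, B * p.2)) t x = c * (A * pt u (A * t) (B * x)) := by
  have h := deriv_comp_mul_left A (fun r => u (r, B * x)) t
  simp only [smul_eq_mul] at h
  simp only [pt, deriv_const_mul_field, h]

theorem px_scale (c A B : ℝ) (u : ℝ × ℝ → ℝ) (t x : ℝ) :
    px (fun p => c * u (A * p.1, B * p.2)) t x = c * (B * px u (A * t) (B * x)) := by
  have h := deriv_comp_mul_left B (fun r => u (A * t, r)) x
  simp only [smul_eq_mul] at h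
  simp only [px, deriv_const_mul_field, h]

theorem ptt_scale (c A B : ℝ) (u : ℝ × ℝ → ℝ) (t x : ℝ) :
    ptt (fun p => c * u (A * p.1, B * p.2)) t x = c * (A * (A * ptt u (A * t) (B * x))) := by
  have h := deriv_comp_mul_left A (fun r => pt u r (B * x)) t
  simp only [smul_eq_mul] at h
  simp only [ptt, pt_scale, deriv_const_mul_field, h]

/-- Rescaling of the flux term `∂ₓ(u ^ m * ∂ₓu)` for positive `u`. -/
theorem deriv_rpow_mul_px_scale {c A B : ℝ} (hc : 0 < c) (hB : 0 < B) (m : ℝ)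
    {u : ℝ × ℝ → ℝ} (hpos : ∀ t x : ℝ, 0 < x → 0 < u (t, x)) (t : ℝ) {x : ℝ} (hx : 0 < x) :
    deriv (fun y => (c * u (A * t, B * y)) ^ m *
        px (fun p => c * u (A * p.1, B * p.2)) t y) x
      = c ^ m * c * B ^ 2 * deriv (fun y => u (A * t, y) ^ m * px u (A * t) y) (B * x) := by
  have hev : (fun y => (c * u (A * t, B * y)) ^ m *
        px (fun p => c * u (A * p.1, B * p.2)) t y) =ᶠ[nhds x]
      fun y => c ^ m * c * B * (u (A * t, B * y) ^ m * px u (A * t) (B * y)) := by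
    filter_upwards [Ioi_mem_nhds hx] with y hy
    rw [px_scale, Real.mul_rpow hc.le (hpos _ _ (mul_pos hB hy)).le]
    ring
  have h := deriv_comp_mul_left B (fun y => u (A * t, y) ^ m * px u (A * t) y) x
  simp only [smul_eq_mul] at h
  rw [hev.deriv_eq, deriv_const_mul_field, h]
  ring

/-- The finite symmetry generated by `[λ(μ−ν)+(μ−2ν)] t ∂_t + 2(μ−ν) x ∂_x + 2u ∂_u`
for the case `H = u^μ`, `K = u^ν`, `f = x^λ` (positive solutions, real powers). -/
theorem symmetry_Hpower_Kpower_fpower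
    (m n l : ℝ)
    (u : ℝ × ℝ → ℝ) (hu : ContDiffOn ℝ 2 u ((Set.univ : Set ℝ) ×ˢ Set.Ioi (0 : ℝ)))
    (hpos : ∀ t x : ℝ, 0 < x → 0 < u (t, x))
    (heq : ∀ t x : ℝ, 0 < x →
      x ^ l * ptt u t x
        = deriv (fun y => u (t, y) ^ m * px u t y) x + u (t, x) ^ n * px u t x)
    (s : ℝ) (v : ℝ × ℝ → ℝ)
    (hv : v = fun p =>
      Real.exp (2 * s) *
        u (Real.exp (-(l * (m - n) + (m - 2 * n)) * s) * p.1,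
           Real.exp (-(2 * (m - n)) * s) * p.2)) :
    ∀ t x : ℝ, 0 < x →
      x ^ l * ptt v t x
        = deriv (fun y => v (t, y) ^ m * px v t y) x + v (t, x) ^ n * px v t x := by
  intro t x hx
  subst hv
  have hAB : Real.exp (2 * s) * Real.exp (-(l * (m - n) + (m - 2 * n)) * s) ^ 2
      = Real.exp ((2 - 2 * m + 4 * n) * s) * Real.exp (-(2 * (m - n)) * s) ^ l := by
    simp only [← Real.exp_mul, ← Real.exp_nat_mul, ← Real.exp_add]
    congr 1; push_cast; ring
  have hm : Real.exp (2 * s) ^ m * Real.exp (2 * s) * Real.exp (-(2 * (m - n)) * s) ^ 2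
      = Real.exp ((2 - 2 * m + 4 * n) * s) := by
    simp only [← Real.exp_mul, ← Real.exp_nat_mul, ← Real.exp_add]
    congr 1; push_cast; ring
  have hn : Real.exp (2 * s) ^ n * Real.exp (2 * s) * Real.exp (-(2 * (m - n)) * s)
      = Real.exp ((2 - 2 * m + 4 * n) * s) := by
    simp only [← Real.exp_mul, ← Real.exp_add]
    congr 1; ring
  have hc := Real.exp_pos (2 * s)
  have hB := Real.exp_pos (-(2 * (m - n)) * s)
  generalize Real.exp (2 * s) = c at *
  generalize Real.exp (-(l * (m - n) + (m - 2 * n)) * s) = A at *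
  generalize Real.exp (-(2 * (m - n)) * s) = B at *
  generalize Real.exp ((2 - 2 * m + 4 * n) * s) = E at *
  have hX := mul_pos hB hx
  have h := heq (A * t) (B * x) hX
  rw [Real.mul_rpow hB.le hx.le] at h
  rw [deriv_rpow_mul_px_scale hc hB m hpos t hx, ptt_scale, px_scale,
    Real.mul_rpow hc.le (hpos _ _ hX).le, hm]
  linear_combination E * h + x ^ l * ptt u (A * t) (B * x) * hAB
    - u (A * t, B * x) ^ n * px u (A * t) (B * x) * hn
end

section
/- Let u : ℝ × ℝ → (0,∞) be twice continuously differentiable and satisfy ∂ₜₜu(t,x) = ∂ₓ(u(t,x)^{−4}·∂ₓu(t,x)) for all (t,x) ∈ ℝ². Then for every ε ∈ ℝ, the function v(t,x) := (1+εt)·u(t/(1+εt), x) satisfies ∂ₜₜv(t,x) = ∂ₓ(v(t,x)^{−4}·∂ₓv(t,x)) for all (t,x) with 1+εt > 0. (This is the finite projective symmetry generated by the operator t²∂_t + tu∂_u admitted by the equation u_tt = (u^{−4}u_x)_x.) -/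
/-- The Möbius change of time `s ↦ s / (1 + e s)` has derivative `(1 + e s)⁻²`. -/
theorem hasDerivAt_div_one_add_mul {e s : ℝ} (hs : 1 + e * s ≠ 0) :
    HasDerivAt (fun r => r / (1 + e * r)) (1 / (1 + e * s) ^ 2) s := by
  have ha : HasDerivAt (fun r => 1 + e * r) e s := by
    simpa using ((hasDerivAt_id s).const_mul e).const_add 1
  refine ((hasDerivAt_id' s).div ha hs).congr_deriv ?_
  congr 1
  ring

/-- The first derivative of the projective transform `s ↦ (1 + e s) g (s / (1 + e s))`. -/
theorem hasDerivAt_projective {g : ℝ → ℝ} (hg : Differentiable ℝ g) {e s : ℝ}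
    (hs : 1 + e * s ≠ 0) :
    HasDerivAt (fun r => (1 + e * r) * g (r / (1 + e * r)))
      (e * g (s / (1 + e * s)) + deriv g (s / (1 + e * s)) / (1 + e * s)) s := by
  have ha : HasDerivAt (fun r => 1 + e * r) e s := by
    simpa using ((hasDerivAt_id s).const_mul e).const_add 1
  have hc := (hg (s / (1 + e * s))).hasDerivAt.comp s (hasDerivAt_div_one_add_mul hs)
  refine (ha.mul hc).congr_deriv ?_
  simp only [Function.comp_apply]
  field_simp

/-- The second derivative of the projective transform `s ↦ (1 + e s) g (s / (1 + e s))`. -/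
theorem deriv_deriv_projective {g : ℝ → ℝ} (hg : Differentiable ℝ g)
    (hg' : Differentiable ℝ (deriv g)) {e t : ℝ} (ht : 1 + e * t ≠ 0) :
    deriv (deriv fun r => (1 + e * r) * g (r / (1 + e * r))) t =
      deriv (deriv g) (t / (1 + e * t)) / (1 + e * t) ^ 3 := by
  have hev : (deriv fun r => (1 + e * r) * g (r / (1 + e * r))) =ᶠ[nhds t]
      fun s => e * g (s / (1 + e * s)) + deriv g (s / (1 + e * s)) / (1 + e * s) := by
    have hcont : ContinuousAt (fun r => 1 + e * r) t := by fun_prop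
    filter_upwards [hcont.eventually_ne ht] with s hs
    exact (hasDerivAt_projective hg hs).deriv
  rw [hev.deriv_eq]
  have ha : HasDerivAt (fun r => 1 + e * r) e t := by
    simpa using ((hasDerivAt_id t).const_mul e).const_add 1
  have hτ := hasDerivAt_div_one_add_mul ht
  have hc := (hg (t / (1 + e * t))).hasDerivAt.comp t hτ
  have hc' := (hg' (t / (1 + e * t))).hasDerivAt.comp t hτ
  refine (((hc.const_mul e).add (hc'.div ha ht)).congr_deriv ?_).deriv
  simp only [Function.comp_apply]
  field_simp
  ring

/-- The finite projective symmetry generated by `t² ∂_t + t u ∂_u` admitted by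
the equation `u_tt = (u^{−4} u_x)_x`. -/
theorem projective_symmetry_Huminus4
    (u : ℝ × ℝ → ℝ) (hu : ContDiff ℝ 2 u) (hpos : ∀ t x : ℝ, 0 < u (t, x))
    (heq : ∀ t x : ℝ,
      ptt u t x = deriv (fun y => u (t, y) ^ (-4 : ℝ) * px u t y) x)
    (e : ℝ) (v : ℝ × ℝ → ℝ)
    (hv : v = fun p => (1 + e * p.1) * u (p.1 / (1 + e * p.1), p.2)) :
    ∀ t x : ℝ, 0 < 1 + e * t →
      ptt v t x = deriv (fun y => v (t, y) ^ (-4 : ℝ) * px v t y) x := by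
  intro t x ht
  subst hv
  have hg : ContDiff ℝ 2 fun s => u (s, x) := hu.comp (by fun_prop)
  have hg' : Differentiable ℝ (deriv fun s => u (s, x)) :=
    ((contDiff_succ_iff_deriv (n := 1)).1 hg).2.2.differentiable one_ne_zero
  have hleft := deriv_deriv_projective (hg.differentiable two_ne_zero) hg' ht.ne'
  have hright : (fun y => ((1 + e * t) * u (t / (1 + e * t), y)) ^ (-4 : ℝ) *
        px (fun p => (1 + e * p.1) * u (p.1 / (1 + e * p.1), p.2)) t y) =
      fun y => 1 / (1 + e * t) ^ 3 *
        (u (t / (1 + e * t), y) ^ (-4 : ℝ) * px u (t / (1 + e * t)) y) := by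
    funext y
    have hpow : (1 + e * t) ^ (-4 : ℝ) = 1 / (1 + e * t) ^ 4 := by
      rw [Real.rpow_neg ht.le, one_div]
      norm_cast
    simp only [px, deriv_const_mul_field]
    rw [Real.mul_rpow ht.le (hpos _ _).le, hpow]
    field_simp
  have heq' := heq (t / (1 + e * t)) x
  refine hleft.trans ?_
  simp only [hright, deriv_const_mul_field, ← heq']
  simp only [ptt, pt]
  rw [div_eq_mul_one_div, mul_comm]
end

section
/- Let H : ℝ → ℝ be continuously differentiable with H(s) ≠ 0 for all s, let G : ℝ → ℝ satisfy G' = H, and let u : ℝ × ℝ → ℝ be twice continuously differentiable and satisfy ∂ₜₜu(t,x) = ∂ₓ(H(u(t,x))·∂ₓu(t,x)) for all (t,x) ∈ ℝ². Define v(t,x) := G(u(x,t)) (interchange of the roles of t and x composed with the substitution ũ = ∫H(u)du). Then ∂ₜₜv(t,x) = ∂ₓ( (∂ₓv)(t,x) / H(u(x,t)) ) for all (t,x) ∈ ℝ²; i.e., v again solves an equation of the form v_tt = (H̃(v)v_x)_x, where the new arbitrary element H̃ = 1/(H∘G⁻¹) is the derivative of the inverse function of G. (This is the generalized extended equivalence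 transformation t̃ = x, x̃ = t, ũ = ∫H(u)du of the class u_tt = (H(u)u_x)_x.) -/
/-- The generalized extended equivalence transformation `t̃ = x`, `x̃ = t`,
`ũ = ∫ H(u) du` of the class `u_tt = (H(u) u_x)_x`. -/
theorem hodograph_type_equivalence
    (H : ℝ → ℝ) (hH : ContDiff ℝ 1 H) (hHne : ∀ s : ℝ, H s ≠ 0)
    (G : ℝ → ℝ) (hG : ∀ s : ℝ, HasDerivAt G (H s) s)
    (u : ℝ × ℝ → ℝ) (hu : ContDiff ℝ 2 u)
    (heq : ∀ t x : ℝ,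
      ptt u t x = deriv (fun y => H (u (t, y)) * px u t y) x)
    (v : ℝ × ℝ → ℝ) (hv : v = fun p => G (u (p.2, p.1))) :
    ∀ t x : ℝ,
      ptt v t x = deriv (fun y => px v t y / H (u (y, t))) x := by
  have hud : Differentiable ℝ u := hu.differentiable (by norm_num)
  subst hv
  intro t x
  have pt_comp (s y : ℝ) :
      pt (fun p => G (u (p.2, p.1))) s y = H (u (y, s)) * px u y s := by
    have h : DifferentiableAt ℝ (fun z => u (y, z)) s := by fun_prop
    exact ((hG (u (y, s))).comp s h.hasDerivAt).deriv
  have px_comp (s y : ℝ) :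
      px (fun p => G (u (p.2, p.1))) s y = H (u (y, s)) * pt u y s := by
    have h : DifferentiableAt ℝ (fun z => u (z, s)) y := by fun_prop
    exact ((hG (u (y, s))).comp y h.hasDerivAt).deriv
  have flux (y : ℝ) :
      px (fun p => G (u (p.2, p.1))) t y / H (u (y, t)) = pt u y t := by
    rw [px_comp, mul_div_cancel_left₀ _ (hHne _)]
  simp only [flux]
  simp only [ptt, pt_comp]
  exact (heq x t).symm
end

section
/- Let H : ℝ → ℝ be continuously differentiable and let u : ℝ × ℝ → ℝ be twice continuously differentiable and satisfy e^{−2x}·∂ₜₜu(t,x) = ∂ₓ(H(u(t,x))·∂ₓu(t,x)) + H(u(t,x))·∂ₓu(t,x) for all (t,x) ∈ ℝ². Then the function v(t,y) := u(t, −ln y), defined for t ∈ ℝ and y > 0, satisfies ∂ₜₜv(t,y) = ∂_y(H(v(t,y))·∂_yv(t,y)) for all t ∈ ℝ, y > 0. (This is the additional equivalence transformation t̃ = t, x̃ = e^{−x}, ũ = u mapping the case f = e^{−2x}, K = H to the case f = 1, K = 0.) -/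
/-- The spatial slices of `px u` are differentiable when `u` is twice continuously
differentiable. -/
theorem differentiable_px {u : ℝ × ℝ → ℝ} (hu : ContDiff ℝ 2 u) (t : ℝ) :
    Differentiable ℝ (px u t) := by
  have hs : ContDiff ℝ 2 (fun x => u (t, x)) := by fun_prop
  exact hs.differentiable_deriv_two

/-- Chain rule for the substitution `x = -log y`. -/
theorem px_comp_neg_log {u : ℝ × ℝ → ℝ} (hu : Differentiable ℝ u) (t : ℝ) {y : ℝ}
    (hy : y ≠ 0) :
    px (fun p => u (p.1, -Real.log p.2)) t y = -(px u t (-Real.log y) / y) := by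
  have hs : Differentiable ℝ (fun x => u (t, x)) := by fun_prop
  have h := (hs (-Real.log y)).hasDerivAt.comp y (Real.hasDerivAt_log hy).neg
  refine h.deriv.trans ?_
  simp only [px]
  ring

/-- The additional equivalence transformation `t̃ = t`, `x̃ = e^{−x}`, `ũ = u`
mapping the case `f = e^{−2x}`, `K = H` to the case `f = 1`, `K = 0`. -/
theorem additional_equivalence_fexp_KH
    (H : ℝ → ℝ) (hH : ContDiff ℝ 1 H)
    (u : ℝ × ℝ → ℝ) (hu : ContDiff ℝ 2 u)
    (heq : ∀ t x : ℝ,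
      Real.exp (-2 * x) * ptt u t x
        = deriv (fun y => H (u (t, y)) * px u t y) x + H (u (t, x)) * px u t x)
    (v : ℝ × ℝ → ℝ) (hv : v = fun p => u (p.1, -Real.log p.2)) :
    ∀ t y : ℝ, 0 < y →
      ptt v t y = deriv (fun z => H (v (t, z)) * px v t z) y := by
  intro t y hy
  subst hv
  have hu' : Differentiable ℝ u := hu.differentiable (by norm_num)
  have hH' : Differentiable ℝ H := hH.differentiable (by norm_num)
  have hpx := differentiable_px hu t
  have hflux : Differentiable ℝ (fun x => H (u (t, x)) * px u t x) := by fun_prop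
  have hcomp := ((hflux (-Real.log y)).hasDerivAt.comp y (Real.hasDerivAt_log hy.ne').neg).mul
    (hasDerivAt_inv hy.ne') |>.neg
  have hlocal : (fun z => H (u (t, -Real.log z)) *
      px (fun p => u (p.1, -Real.log p.2)) t z) =ᶠ[nhds y]
      fun z => -(H (u (t, -Real.log z)) * px u t (-Real.log z) * z⁻¹) := by
    filter_upwards [eventually_ne_nhds hy.ne'] with z hz
    rw [px_comp_neg_log hu' t hz]
    ring
  have hexp : Real.exp (-2 * -Real.log y) = y ^ 2 := by
    rw [show -2 * -Real.log y = Real.log y + Real.log y by ring, Real.exp_add, Real.exp_log hy]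
    ring
  have hpde := heq t (-Real.log y)
  rw [hexp] at hpde
  refine Eq.trans ?_ (hlocal.deriv_eq.trans hcomp.deriv).symm
  change ptt u t (-Real.log y) = _
  simp only [Function.comp_apply]
  field_simp
  linear_combination hpde
end

section
/- Let u : ℝ × (0,∞) → ℝ be twice continuously differentiable and satisfy x^{−3}·∂ₜₜu(t,x) = ∂ₓ(e^{u(t,x)}·∂ₓu(t,x)) for all t ∈ ℝ, x > 0. Then the function v(t,y) := u(t, 1/y) + ln y, defined for t ∈ ℝ and y > 0, satisfies ∂ₜₜv(t,y) = ∂_y(e^{v(t,y)}·∂_yv(t,y)) for all t ∈ ℝ, y > 0. (This is the additional equivalence transformation t̃ = t·sign x, x̃ = 1/x, ũ = u − ln|x| mapping the case H = e^u, K = 0, f = x^{−3} to the constant coefficient equation u_tt = (e^u u_x)_x.) -/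
/-- The spatial slices of a function that is `C²` on `ℝ × (0, ∞)` are `C²` on `(0, ∞)`. -/
theorem contDiffOn_spatial_slice {u : ℝ × ℝ → ℝ}
    (hu : ContDiffOn ℝ 2 u ((Set.univ : Set ℝ) ×ˢ Set.Ioi (0 : ℝ))) (t : ℝ) :
    ContDiffOn ℝ 2 (fun x => u (t, x)) (Set.Ioi 0) :=
  hu.comp (contDiff_prodMk_right t).contDiffOn fun _ hx => ⟨Set.mem_univ _, hx⟩

/-- If `w` is `C²` on `(0, ∞)` and `W z = w (1 / z) + log z`, then
`(e ^ W * W')' (y) = (e ^ w * w')' (1 / y) / y ^ 3`. -/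
theorem deriv_exp_mul_deriv_inversion {w : ℝ → ℝ} (hw : ContDiffOn ℝ 2 w (Set.Ioi 0))
    {y : ℝ} (hy : 0 < y) :
    deriv (fun z => Real.exp (w (1 / z) + Real.log z) *
        deriv (fun z => w (1 / z) + Real.log z) z) y =
      deriv (fun x => Real.exp (w x) * deriv w x) (1 / y) / y ^ 3 := by
  have hw₁ : ∀ x, 0 < x → HasDerivAt w (deriv w x) x := fun x hx =>
    ((hw.differentiableOn two_ne_zero).differentiableAt (Ioi_mem_nhds hx)).hasDerivAt
  have hw₂ : ∀ x, 0 < x → DifferentiableAt ℝ (deriv w) x := fun x hx =>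
    ((((contDiffOn_succ_iff_deriv_of_isOpen (n := 1) isOpen_Ioi).1 hw).2.2).differentiableOn
      one_ne_zero).differentiableAt (Ioi_mem_nhds hx)
  have hinv : ∀ z : ℝ, 0 < z → HasDerivAt (fun z : ℝ => 1 / z) (-(z ^ 2)⁻¹) z := fun z hz => by
    simpa only [one_div] using hasDerivAt_inv hz.ne'
  have hy' : 0 < 1 / y := one_div_pos.2 hy
  have hflux : (fun z => Real.exp (w (1 / z) + Real.log z) *
      deriv (fun z => w (1 / z) + Real.log z) z) =ᶠ[nhds y]
      fun z => Real.exp (w (1 / z)) - Real.exp (w (1 / z)) * deriv w (1 / z) * (1 / z) := by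
    filter_upwards [Ioi_mem_nhds hy] with z hz
    have hz : 0 < z := hz
    have hd := ((hw₁ _ (one_div_pos.2 hz)).comp z (hinv z hz)).add (Real.hasDerivAt_log hz.ne')
    have hd' : deriv (fun z => w (1 / z) + Real.log z) z = _ := hd.deriv
    rw [hd', Real.exp_add, Real.exp_log hz]
    field_simp
    ring
  rw [hflux.deriv_eq]
  have hE := (hw₁ _ hy').exp.comp y (hinv y hy)
  have hG := (((hw₁ _ hy').exp.differentiableAt.mul (hw₂ _ hy')).hasDerivAt).comp y (hinv y hy)
  refine ((hE.sub (hG.mul (hinv y hy))).deriv).trans ?_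
  simp only [Function.comp_apply, Pi.mul_apply]
  change _ = deriv ((fun x => Real.exp (w x)) * deriv w) (1 / y) / y ^ 3
  field_simp
  ring

/-- The additional equivalence transformation `t̃ = t·sign x`, `x̃ = 1/x`,
`ũ = u − ln|x|` mapping the case `H = e^u`, `K = 0`, `f = x^{−3}` (on `x > 0`)
to the constant coefficient equation `u_tt = (e^u u_x)_x`. -/
theorem additional_equivalence_Hexp_fxminus3
    (u : ℝ × ℝ → ℝ) (hu : ContDiffOn ℝ 2 u ((Set.univ : Set ℝ) ×ˢ Set.Ioi (0 : ℝ)))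
    (heq : ∀ t x : ℝ, 0 < x →
      x ^ (-3 : ℝ) * ptt u t x
        = deriv (fun y => Real.exp (u (t, y)) * px u t y) x)
    (v : ℝ × ℝ → ℝ) (hv : v = fun p => u (p.1, 1 / p.2) + Real.log p.2) :
    ∀ t y : ℝ, 0 < y →
      ptt v t y = deriv (fun z => Real.exp (v (t, z)) * px v t z) y := by
  intro t y hy
  subst hv
  have htt : ptt (fun p => u (p.1, 1 / p.2) + Real.log p.2) t y = ptt u t (1 / y) := by
    simp only [ptt, pt, deriv_add_const]
  have hx := heq t (1 / y) (one_div_pos.2 hy)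
  have hpow : (1 / y) ^ (-3 : ℝ) = y ^ 3 := by
    rw [one_div, Real.inv_rpow hy.le, Real.rpow_neg hy.le, inv_inv]
    exact_mod_cast Real.rpow_natCast y 3
  rw [hpow] at hx
  simp only [px] at hx ⊢
  rw [htt, deriv_exp_mul_deriv_inversion (contDiffOn_spatial_slice hu t) hy, ← hx]
  field_simp
end

section
/- Let γ ∈ ℝ and let u : ℝ × ℝ → ℝ be twice continuously differentiable with u(t,x) ≠ 0 for all (t,x), satisfying e^{γx}·∂ₜₜu(t,x) = ∂ₓ(u(t,x)^{−1}·∂ₓu(t,x)) for all (t,x) ∈ ℝ². Then the function v(t,x) := e^{γx}·u(t,x) satisfies ∂ₜₜv(t,x) = ∂ₓ(v(t,x)^{−1}·∂ₓv(t,x)) for all (t,x) ∈ ℝ². (This is the additional equivalence transformation t̃ = t, x̃ = x, ũ = e^{γx}u mapping the case H = u^{−1}, K = 0, f = e^{γx} to the constant coefficient equation u_tt = (u^{−1}u_x)_x.) -/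
/-- The additional equivalence transformation `t̃ = t`, `x̃ = x`, `ũ = e^{γx} u`
mapping the case `H = u^{−1}`, `K = 0`, `f = e^{γx}` to the constant
coefficient equation `u_tt = (u^{−1} u_x)_x`. -/
theorem additional_equivalence_Huminus1_fexp
    (g : ℝ)
    (u : ℝ × ℝ → ℝ) (hu : ContDiff ℝ 2 u) (hne : ∀ t x : ℝ, u (t, x) ≠ 0)
    (heq : ∀ t x : ℝ,
      Real.exp (g * x) * ptt u t x
        = deriv (fun y => (u (t, y))⁻¹ * px u t y) x)
    (v : ℝ × ℝ → ℝ) (hv : v = fun p => Real.exp (g * p.2) * u (p.1, p.2)) :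
    ∀ t x : ℝ,
      ptt v t x = deriv (fun y => (v (t, y))⁻¹ * px v t y) x := by
  intro t x
  subst hv
  have hflux : (fun y => (Real.exp (g * y) * u (t, y))⁻¹ *
      px (fun p => Real.exp (g * p.2) * u (p.1, p.2)) t y)
      = fun y => g + (u (t, y))⁻¹ * px u t y := by
    funext y
    have hu_x : DifferentiableAt ℝ (fun z => u (t, z)) y :=
      (hu.differentiable two_ne_zero).comp (by fun_prop) |>.differentiableAt
    have hexp : HasDerivAt (fun z => Real.exp (g * z)) (Real.exp (g * y) * g) y := by
      simpa using ((hasDerivAt_id y).const_mul g).exp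
    have hprod : px (fun p => Real.exp (g * p.2) * u (p.1, p.2)) t y
        = Real.exp (g * y) * g * u (t, y) + Real.exp (g * y) * px u t y :=
      (hexp.mul hu_x.hasDerivAt).deriv
    have hexp_ne := Real.exp_ne_zero (g * y)
    have hu_ne := hne t y
    rw [hprod]
    field_simp
  have hptt : ptt (fun p => Real.exp (g * p.2) * u (p.1, p.2)) t x
      = Real.exp (g * x) * ptt u t x := by
    simp only [ptt, pt, deriv_const_mul_field]
  rw [hptt, heq t x, hflux, deriv_const_add]
end

section
/- Let u : ℝ × ℝ → ℝ be twice continuously differentiable with u(t,x) ≠ 0 for all (t,x), satisfying ∂ₜₜu(t,x) = ∂ₓ(u(t,x)^{−2}·∂ₓu(t,x)) + u(t,x)^{−2}·∂ₓu(t,x) for all (t,x) ∈ ℝ². Then the function v(t,y) := u(t, ln y)/y, defined for t ∈ ℝ and y > 0, satisfies ∂ₜₜv(t,y) = ∂_y(v(t,y)^{−2}·∂_yv(t,y)) for all t ∈ ℝ, y > 0. (This is the additional equivalence transformation t̃ = t, x̃ = e^x, ũ = e^{−x}u mapping the case H = K = u^{−2}, f = 1 to the equation u_tt = (u^{−2}u_x)_x.)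 -/
/-- Dividing by `y` and substituting `x = log y` commutes with the second `t`-derivative. -/
lemma ptt_comp_log_div (u : ℝ × ℝ → ℝ) (t y : ℝ) :
    ptt (fun p => u (p.1, Real.log p.2) / p.2) t y = ptt u t (Real.log y) / y := by
  simp only [ptt, pt, deriv_div_const]

/-- The flux `w⁻² w'` of `w z = g (log z) / z`, expressed through `g`. -/
lemma flux_comp_log_div {g : ℝ → ℝ} (hg : Differentiable ℝ g) (hne : ∀ x, g x ≠ 0)
    {z : ℝ} (hz : 0 < z) :
    (g (Real.log z) / z) ^ (-2 : ℤ) * deriv (fun y => g (Real.log y) / y) z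
      = g (Real.log z) ^ (-2 : ℤ) * deriv g (Real.log z) - (g (Real.log z))⁻¹ := by
  have h := (((hg (Real.log z)).hasDerivAt.comp z (Real.hasDerivAt_log hz.ne')).div
    (hasDerivAt_id z) hz.ne').deriv
  have h' : deriv (fun y => g (Real.log y) / y) z
      = (deriv g (Real.log z) * z⁻¹ * z - g (Real.log z) * 1) / z ^ 2 := h
  have hgz := hne (Real.log z)
  rw [h', zpow_neg, zpow_neg]
  norm_cast
  field_simp

/-- The derivative of the flux of `w z = g (log z) / z`. -/
lemma deriv_flux_comp_log_div {g : ℝ → ℝ} (hg : ContDiff ℝ 2 g) (hne : ∀ x, g x ≠ 0)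
    {y : ℝ} (hy : 0 < y) :
    deriv (fun z => (g (Real.log z) / z) ^ (-2 : ℤ) * deriv (fun y => g (Real.log y) / y) z) y
      = (deriv (fun x => g x ^ (-2 : ℤ) * deriv g x) (Real.log y)
          + g (Real.log y) ^ (-2 : ℤ) * deriv g (Real.log y)) / y := by
  have hd : Differentiable ℝ g := hg.differentiable (by norm_num)
  have hd' : Differentiable ℝ (deriv g) :=
    ((contDiff_succ_iff_deriv (n := 1)).1 hg).2.2.differentiable (by norm_num)
  have hev : (fun z => (g (Real.log z) / z) ^ (-2 : ℤ) * deriv (fun y => g (Real.log y) / y) z)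
      =ᶠ[nhds y] (fun x => g x ^ (-2 : ℤ) * deriv g x - (g x)⁻¹) ∘ Real.log := by
    filter_upwards [lt_mem_nhds hy] with z hz
    exact flux_comp_log_div hd hne hz
  have hgy := hne (Real.log y)
  have hflux : DifferentiableAt ℝ (fun x => g x ^ (-2 : ℤ) * deriv g x) (Real.log y) :=
    ((hd _).zpow (Or.inl hgy)).mul (hd' _)
  have hderiv := (hflux.hasDerivAt.sub ((hd (Real.log y)).hasDerivAt.inv hgy)).comp y
    (Real.hasDerivAt_log hy.ne')
  refine hev.deriv_eq.trans (hderiv.deriv.trans ?_)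
  rw [zpow_neg]
  norm_cast
  field_simp
  ring

/-- The additional equivalence transformation `t̃ = t`, `x̃ = e^x`, `ũ = e^{−x} u`
mapping the case `H = K = u^{−2}`, `f = 1` to the equation `u_tt = (u^{−2} u_x)_x`. -/
theorem additional_equivalence_Huminus2
    (u : ℝ × ℝ → ℝ) (hu : ContDiff ℝ 2 u) (hne : ∀ t x : ℝ, u (t, x) ≠ 0)
    (heq : ∀ t x : ℝ,
      ptt u t x
        = deriv (fun y => u (t, y) ^ (-2 : ℤ) * px u t y) x
          + u (t, x) ^ (-2 : ℤ) * px u t x)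
    (v : ℝ × ℝ → ℝ) (hv : v = fun p => u (p.1, Real.log p.2) / p.2) :
    ∀ t y : ℝ, 0 < y →
      ptt v t y = deriv (fun z => v (t, z) ^ (-2 : ℤ) * px v t z) y := by
  intro t y hy
  subst hv
  have hg : ContDiff ℝ 2 (fun x => u (t, x)) := hu.comp (by fun_prop)
  rw [ptt_comp_log_div, heq]
  exact (deriv_flux_comp_log_div hg (hne t) hy).symm
end

section
/- Let c₀, c₁ ∈ ℝ and let Ω := {(t,x) ∈ ℝ² : t ≠ 0 and x² + c₁x + c₀ > 0}. Then the function u(t,x) := ln((x² + c₁x + c₀)/t²) satisfies ∂ₜₜu(t,x) = ∂ₓ(e^{u(t,x)}·∂ₓu(t,x)) at every point of Ω. (This is the exact solution of the nonlinear wave equation u_tt = (e^u u_x)_x obtained from the Lie reduction by the subalgebra ⟨t∂_t − 2∂_u⟩.) -/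
theorem hasDerivAt_log_div_sq {a s : ℝ} (ha : a ≠ 0) (hs : s ≠ 0) :
    HasDerivAt (fun r : ℝ => Real.log (a / r ^ 2)) (-2 * s⁻¹) s := by
  have hdiv := (hasDerivAt_const s a).div (hasDerivAt_pow 2 s) (pow_ne_zero 2 hs)
  refine (hdiv.log (div_ne_zero ha (pow_ne_zero 2 hs))).congr_deriv ?_
  simp only [Pi.div_apply]
  field_simp
  push_cast
  ring

theorem hasDerivAt_quadratic (c0 c1 y : ℝ) :
    HasDerivAt (fun z : ℝ => z ^ 2 + c1 * z + c0) (2 * y + c1) y := by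
  refine (((hasDerivAt_pow 2 y).add ((hasDerivAt_id y).const_mul c1)).add_const c0).congr_deriv ?_
  simp

/-- The exact solution `u = ln((x² + c₁x + c₀)/t²)` of the nonlinear wave
equation `u_tt = (e^u u_x)_x`. -/
theorem exact_solution_log_quadratic
    (c0 c1 : ℝ) (u : ℝ × ℝ → ℝ)
    (hu : u = fun p => Real.log ((p.2 ^ 2 + c1 * p.2 + c0) / p.1 ^ 2)) :
    ∀ t x : ℝ, t ≠ 0 → 0 < x ^ 2 + c1 * x + c0 →
      ptt u t x = deriv (fun y => Real.exp (u (t, y)) * px u t y) x := by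
  subst hu
  intro t x ht hx
  have hpt : (fun s => pt (fun p => Real.log ((p.2 ^ 2 + c1 * p.2 + c0) / p.1 ^ 2)) s x)
      =ᶠ[nhds t] fun s => -2 * s⁻¹ := by
    filter_upwards [isOpen_ne.mem_nhds ht] with s hs
    exact (hasDerivAt_log_div_sq hx.ne' hs).deriv
  have hflux : (fun y => Real.exp (Real.log ((y ^ 2 + c1 * y + c0) / t ^ 2)) *
        px (fun p => Real.log ((p.2 ^ 2 + c1 * p.2 + c0) / p.1 ^ 2)) t y)
      =ᶠ[nhds x] fun y => (2 * y + c1) / t ^ 2 := by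
    have hcont : Continuous fun y : ℝ => y ^ 2 + c1 * y + c0 := by fun_prop
    filter_upwards [hcont.continuousAt.eventually (lt_mem_nhds hx)] with y hy
    have hdiv : 0 < (y ^ 2 + c1 * y + c0) / t ^ 2 := by positivity
    have hlog := ((hasDerivAt_quadratic c0 c1 y).div_const (t ^ 2)).log hdiv.ne'
    rw [Real.exp_log hdiv, px, hlog.deriv, mul_div_cancel₀ _ hdiv.ne']
  have hlhs : HasDerivAt (fun s : ℝ => -2 * s⁻¹) (2 / t ^ 2) t := by
    refine ((hasDerivAt_inv ht).const_mul (-2)).congr_deriv ?_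
    ring
  have hrhs : HasDerivAt (fun y : ℝ => (2 * y + c1) / t ^ 2) (2 / t ^ 2) x := by
    refine ((((hasDerivAt_id x).const_mul 2).add_const c1).div_const (t ^ 2)).congr_deriv ?_
    ring
  rw [ptt, hpt.deriv_eq, hflux.deriv_eq, hlhs.deriv, hrhs.deriv]
end

section
/- Let c₁ ∈ ℝ \ {0} and c₂ ∈ ℝ, and let Ω := {(t,x) ∈ ℝ² : t ≠ 0 and cos((x+c₂)/(2c₁)) ≠ 0}. Then the function u(t,x) := t²/(4c₁²·cos²((x+c₂)/(2c₁))) satisfies ∂ₜₜu(t,x) = ∂ₓ(u(t,x)^{−1}·∂ₓu(t,x)) at every point of Ω. (This is an exact solution of the nonlinear wave equation u_tt = (u^{−1}u_x)_x.) -/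
/-- The exact solution `u = t²/(4c₁² cos²((x+c₂)/(2c₁)))` of the nonlinear wave
equation `u_tt = (u^{−1} u_x)_x`. -/
theorem exact_solution_sec_squared
    (c1 c2 : ℝ) (hc1 : c1 ≠ 0) (u : ℝ × ℝ → ℝ)
    (hu : u = fun p => p.1 ^ 2 / (4 * c1 ^ 2 * Real.cos ((p.2 + c2) / (2 * c1)) ^ 2)) :
    ∀ t x : ℝ, t ≠ 0 → Real.cos ((x + c2) / (2 * c1)) ≠ 0 →
      ptt u t x = deriv (fun y => (u (t, y))⁻¹ * px u t y) x := by
  intro t x ht hx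
  subst hu
  have hθ : ∀ y : ℝ, HasDerivAt (fun y : ℝ => (y + c2) / (2 * c1)) (1 / (2 * c1)) y :=
    fun y => ((hasDerivAt_id y).add_const c2).div_const _
  have hpt : ∀ s : ℝ,
      pt (fun p => p.1 ^ 2 / (4 * c1 ^ 2 * Real.cos ((p.2 + c2) / (2 * c1)) ^ 2)) s x
        = 2 * s / (4 * c1 ^ 2 * Real.cos ((x + c2) / (2 * c1)) ^ 2) := by
    intro s
    simp [pt]
  have hptt : ptt (fun p => p.1 ^ 2 / (4 * c1 ^ 2 * Real.cos ((p.2 + c2) / (2 * c1)) ^ 2)) t x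
      = 2 / (4 * c1 ^ 2 * Real.cos ((x + c2) / (2 * c1)) ^ 2) := by
    unfold ptt
    simp_rw [hpt]
    simp
  have hne : ∀ᶠ y in nhds x, Real.cos ((y + c2) / (2 * c1)) ≠ 0 :=
    ContinuousAt.eventually_ne (by fun_prop) hx
  have hlog : (fun y => (t ^ 2 / (4 * c1 ^ 2 * Real.cos ((y + c2) / (2 * c1)) ^ 2))⁻¹ *
      px (fun p => p.1 ^ 2 / (4 * c1 ^ 2 * Real.cos ((p.2 + c2) / (2 * c1)) ^ 2)) t y)
      =ᶠ[nhds x] fun y => Real.tan ((y + c2) / (2 * c1)) / c1 := by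
    filter_upwards [hne] with y hy
    have hden : 4 * c1 ^ 2 * Real.cos ((y + c2) / (2 * c1)) ^ 2 ≠ 0 := by positivity
    have hpx := ((hasDerivAt_const y (t ^ 2)).fun_div
      ((((hθ y).cos).fun_pow 2).const_mul (4 * c1 ^ 2)) hden).deriv
    unfold px
    rw [hpx, Real.tan_eq_sin_div_cos]
    generalize Real.cos ((y + c2) / (2 * c1)) = c at *
    field_simp
    push_cast
    ring
  have htan : HasDerivAt (fun y => Real.tan ((y + c2) / (2 * c1)) / c1)
      (1 / Real.cos ((x + c2) / (2 * c1)) ^ 2 * (1 / (2 * c1)) / c1) x :=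
    HasDerivAt.div_const
      (HasDerivAt.comp (h₂ := Real.tan) x (Real.hasDerivAt_tan hx) (hθ x)) c1
  rw [hptt, hlog.deriv_eq, htan.deriv]
  field_simp
  norm_num
end

section
/- Let c₁, c₂ ∈ ℝ and let Ω := {(t,x) ∈ ℝ² : x ≠ 0 and t² + c₂t + c₁ ≠ 0}. Then the function u(t,x) := x^{−2}·(t² + c₂t + c₁) satisfies ∂ₜₜu(t,x) = ∂ₓ(u(t,x)^{−1}·∂ₓu(t,x)) at every point of Ω. (This is an exact solution of the nonlinear wave equation u_tt = (u^{−1}u_x)_x.) -/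
/-- The exact solution `u = x^{−2}(t² + c₂t + c₁)` of the nonlinear wave
equation `u_tt = (u^{−1} u_x)_x`. -/
theorem exact_solution_xminus2_quadratic
    (c1 c2 : ℝ) (u : ℝ × ℝ → ℝ)
    (hu : u = fun p => (p.1 ^ 2 + c2 * p.1 + c1) / p.2 ^ 2) :
    ∀ t x : ℝ, x ≠ 0 → t ^ 2 + c2 * t + c1 ≠ 0 →
      ptt u t x = deriv (fun y => (u (t, y))⁻¹ * px u t y) x := by
  intro t x hx hq
  subst hu
  have ht : ∀ s : ℝ, HasDerivAt (fun r : ℝ => (r ^ 2 + c2 * r + c1) / x ^ 2)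
      ((2 * s + c2) / x ^ 2) s := fun s =>
    (((((hasDerivAt_id' s).pow 2).add ((hasDerivAt_id' s).const_mul c2)).add_const
      c1).div_const (x ^ 2)).congr_deriv (by norm_num)
  have htt : HasDerivAt (fun s : ℝ => (2 * s + c2) / x ^ 2) (2 / x ^ 2) t :=
    ((((hasDerivAt_id' t).const_mul 2).add_const c2).div_const (x ^ 2)).congr_deriv (by norm_num)
  have hflux : HasDerivAt (fun y : ℝ => -2 * y⁻¹) (2 / x ^ 2) x :=
    ((hasDerivAt_inv hx).const_mul (-2)).congr_deriv (by ring)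
  simp only [ptt, pt, px]
  rw [funext fun s => (ht s).deriv, htt.deriv]
  generalize t ^ 2 + c2 * t + c1 = q at hq ⊢
  have hquot : (fun y : ℝ => (q / y ^ 2)⁻¹ * deriv (fun z : ℝ => q / z ^ 2) y) =ᶠ[nhds x]
      fun y => -2 * y⁻¹ := by
    filter_upwards [isOpen_ne.mem_nhds hx] with y (hy : y ≠ 0)
    have hder : HasDerivAt (fun z : ℝ => q / z ^ 2) (-2 * q / y ^ 3) y :=
      ((hasDerivAt_const y q).div ((hasDerivAt_id' y).pow 2) (pow_ne_zero 2 hy)).congr_deriv (by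
        simp only [Pi.pow_apply]
        field_simp
        norm_num
        ring)
    rw [hder.deriv]
    field_simp
  rw [hquot.deriv_eq, hflux.deriv]
end

section
/- Let λ > 0, c₁ ∈ ℝ \ {0}, c₂, c₃, c₄ ∈ ℝ, and let Ω := {(t,x) ∈ ℝ² : cos((t+c₂)/(2c₁)) ≠ 0 and (λ/2)x² − c₃x + c₄ > 0}. Then the additively separated function u(t,x) := ln( 1/(2λc₁²·cos²((t+c₂)/(2c₁))) ) + ln( (λ/2)x² − c₃x + c₄ ) satisfies ∂ₜₜu(t,x) = ∂ₓ(e^{u(t,x)}·∂ₓu(t,x)) at every point of Ω. (This is the functionally separated solution of u_tt = (e^u u_x)_x obtained via generalized conditional symmetry, where φ(t) = ln(sec²((t+c₂)/(2c₁))/(2λc₁²)) solves φ'' = λe^{φ} and ψ(x) = ln((λ/2)x² − c₃x + c₄) solves (e^{ψ}ψ')' = λ; it cannot be obtained by the classical Lie–Ovsiannikov algorithm.) -/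
/-- The temporal factor `φ(t) = ln(1/(2λc₁² cos²((t+c₂)/(2c₁))))` has derivative
`tan((t+c₂)/(2c₁))/c₁`. -/
theorem hasDerivAt_log_one_div_cos_sq {l c1 : ℝ} (c2 : ℝ) (hl : 0 < l) (hc1 : c1 ≠ 0) {t : ℝ}
    (ht : Real.cos ((t + c2) / (2 * c1)) ≠ 0) :
    HasDerivAt (fun s => Real.log (1 / (2 * l * c1 ^ 2 * Real.cos ((s + c2) / (2 * c1)) ^ 2)))
      (Real.tan ((t + c2) / (2 * c1)) / c1) t := by
  have hg : HasDerivAt (fun s : ℝ => (s + c2) / (2 * c1)) (1 / (2 * c1)) t :=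
    ((hasDerivAt_id t).add_const c2).div_const _
  have hne : 2 * l * c1 ^ 2 * Real.cos ((t + c2) / (2 * c1)) ^ 2 ≠ 0 := by positivity
  have h := (((hg.cos.fun_pow 2).const_mul (2 * l * c1 ^ 2)).log hne).neg
  simp only [one_div, Real.log_inv]
  refine h.congr_deriv ?_
  rw [Real.tan_eq_sin_div_cos]
  field_simp
  norm_num
  ring

/-- The derivative of `tan((t+c₂)/(2c₁))/c₁` is `1/(2c₁² cos²((t+c₂)/(2c₁)))`. -/
theorem hasDerivAt_tan_div {c1 : ℝ} (c2 : ℝ) {t : ℝ}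
    (ht : Real.cos ((t + c2) / (2 * c1)) ≠ 0) :
    HasDerivAt (fun s => Real.tan ((s + c2) / (2 * c1)) / c1)
      (1 / (2 * c1 ^ 2 * Real.cos ((t + c2) / (2 * c1)) ^ 2)) t := by
  have hg : HasDerivAt (fun s : ℝ => (s + c2) / (2 * c1)) (1 / (2 * c1)) t :=
    ((hasDerivAt_id t).add_const c2).div_const _
  refine (((Real.hasDerivAt_tan ht).comp t hg).div_const c1).congr_deriv ?_
  field_simp

theorem hasDerivAt_quadratic_s19 (l c3 c4 x : ℝ) :
    HasDerivAt (fun y => l / 2 * y ^ 2 - c3 * y + c4) (l * x - c3) x := by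
  refine (((((hasDerivAt_id x).fun_pow 2).const_mul (l / 2)).sub
    ((hasDerivAt_id x).const_mul c3)).add_const c4).congr_deriv ?_
  simp
  ring

/-- The functionally (additively) separated solution of `u_tt = (e^u u_x)_x`
obtained via generalized conditional symmetry:
`u = ln(1/(2λc₁² cos²((t+c₂)/(2c₁)))) + ln((λ/2)x² − c₃x + c₄)`. -/
theorem functionally_separated_solution_exp
    (l c1 c2 c3 c4 : ℝ) (hl : 0 < l) (hc1 : c1 ≠ 0) (u : ℝ × ℝ → ℝ)
    (hu : u = fun p =>
      Real.log (1 / (2 * l * c1 ^ 2 * Real.cos ((p.1 + c2) / (2 * c1)) ^ 2))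
        + Real.log (l / 2 * p.2 ^ 2 - c3 * p.2 + c4)) :
    ∀ t x : ℝ, Real.cos ((t + c2) / (2 * c1)) ≠ 0 →
        0 < l / 2 * x ^ 2 - c3 * x + c4 →
      ptt u t x = deriv (fun y => Real.exp (u (t, y)) * px u t y) x := by
  intro t x ht hx
  subst hu
  have hcos : ∀ᶠ s in nhds t, Real.cos ((s + c2) / (2 * c1)) ≠ 0 :=
    ContinuousAt.eventually_ne (by fun_prop) ht
  have hpos : ∀ᶠ y in nhds x, 0 < l / 2 * y ^ 2 - c3 * y + c4 :=
    (hasDerivAt_quadratic_s19 l c3 c4 x).continuousAt.eventually_const_lt hx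
  set K := 1 / (2 * l * c1 ^ 2 * Real.cos ((t + c2) / (2 * c1)) ^ 2) with hK
  have hKpos : 0 < K := by positivity
  have htt : ptt (fun p : ℝ × ℝ =>
      Real.log (1 / (2 * l * c1 ^ 2 * Real.cos ((p.1 + c2) / (2 * c1)) ^ 2))
        + Real.log (l / 2 * p.2 ^ 2 - c3 * p.2 + c4)) t x
      = 1 / (2 * c1 ^ 2 * Real.cos ((t + c2) / (2 * c1)) ^ 2) := by
    refine ((hasDerivAt_tan_div c2 ht).congr_of_eventuallyEq ?_).deriv
    filter_upwards [hcos] with s hs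
    exact ((hasDerivAt_log_one_div_cos_sq c2 hl hc1 hs).add_const
      (Real.log (l / 2 * x ^ 2 - c3 * x + c4))).deriv
  have hflux : HasDerivAt (fun y => K * (l * y - c3)) (K * l) x := by
    simpa using (((hasDerivAt_id x).const_mul l).sub_const c3).const_mul K
  rw [htt, (hflux.congr_of_eventuallyEq ?_).deriv]
  · rw [hK]
    field_simp
  · filter_upwards [hpos] with y hy
    have hpx := (((hasDerivAt_quadratic_s19 l c3 c4 y).log hy.ne').const_add (Real.log K)).deriv
    simp only [px, ← hK]
    rw [hpx, Real.exp_add, Real.exp_log hKpos, Real.exp_log hy, mul_assoc, mul_div_cancel₀ _ hy.ne']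
end
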